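/- A family of sequences [X_{n,j}]_{n≥1, j=1,…,M} of random variables with values in a Polish space is partially exchangeable in the sense of de Finetti if and only if for every finite k ≤ M and every n ≥ 0 the following conditions hold, where P_n denotes a regular conditional distribution of (X_{n+1,1},…,X_{n+1,k}) given (X_{m,j})_{m≤n, j≤k} and P_0(·|(x_{m,j})_{m≤0,j≤k}) means the law P_0 of (X_{1,1},…,X_{1,k}): (i) for all measurable sets A_1,…,A_k and every i = 1,…,k, P_n(A_1×…×A_k | (x_{m,j})_{m≤n,j≤k}) is symmetric in (x_{1,i},…,x_{n,i}); (ii) the set function mapping {A_j, B_j : j ≤ k} to ∫_{A_1×…×A_k} P_{n+1}(B_1×…×B_k | (x_{m,j})_{m≤n+1,j≤k}) dP_n((x_{n+1,1},…,x_{n+1,k}) | (x_{m,j})_{m≤n,j≤k}) is symmetric in (A_i, B_i) for every i = 1,…,k. -/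

import Mathlib

open MeasureTheory ProbabilityTheory Filter Topology
open scoped ENNReal NNReal

/-- A family of sequences `[X_{n,j}]` (columns indexed by `J`) is partially exchangeable in the
sense of de Finetti if its joint law is invariant under separate finite permutations within each
column. -/
def PartiallyExchangeable {Ω 𝕏 J : Type*} [MeasurableSpace Ω] [MeasurableSpace 𝕏]
    (μ : Measure Ω) (X : ℕ → J → Ω → 𝕏) : Prop :=
  ∀ σ : J → Equiv.Perm ℕ, (∀ j, {n | σ j n ≠ n}.Finite) →
    Measure.map (fun ω (p : ℕ × J) => X (σ p.2 p.1) p.2 ω) μ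
      = Measure.map (fun ω (p : ℕ × J) => X p.1 p.2 ω) μ

/-- `(P n)_{n≥0}` is (a version of) the predictive rule of the sequence `Y` of `𝕐`-valued
random variables under `μ`: `P n` is a regular conditional distribution of `Y_{n+1}` given
`(Y_1,…,Y_n)`, and `P 0` is the law of `Y_1`. -/
def IsPredictiveRule {Ω 𝕐 : Type*} [MeasurableSpace Ω] [MeasurableSpace 𝕐]
    (μ : Measure Ω) (Y : ℕ → Ω → 𝕐)
    (P : (n : ℕ) → Kernel (Fin n → 𝕐) 𝕐) : Prop :=
  ∀ (n : ℕ) (A : Set 𝕐) (B : Set (Fin n → 𝕐)), MeasurableSet A → MeasurableSet B →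
    μ {ω | (fun i : Fin n => Y i ω) ∈ B ∧ Y n ω ∈ A}
      = ∫⁻ x in B, P n x A ∂(Measure.map (fun ω (i : Fin n) => Y i ω) μ)

section PredictiveCharacterization

variable {Ω 𝕐 𝕏 K α β : Type*}

/-- The first `n` terms of a sequence of random variables. -/
def pastRows (Y : ℕ → Ω → 𝕐) (n : ℕ) (ω : Ω) : Fin n → 𝕐 := fun i => Y i ω

/-- Reindex the rows of an array by a separate selection in each column. -/
def colSelect (e : K → α → β) (x : β → K → 𝕏) : α → K → 𝕏 := fun a j => x (e j a) j

/-- Exchange the entries of two rows in column `i`. -/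
def swapCol [DecidableEq K] (i : K) (p : (K → 𝕏) × (K → 𝕏)) : (K → 𝕏) × (K → 𝕏) :=
  (Function.update p.1 i (p.2 i), Function.update p.2 i (p.1 i))

theorem pastRows_succ (Y : ℕ → Ω → 𝕐) (n : ℕ) (ω : Ω) :
    pastRows Y (n + 1) ω = Fin.snoc (pastRows Y n ω) (Y n ω) := by
  ext a
  induction a using Fin.lastCases with
  | last => simp [pastRows]
  | cast a => simp [pastRows]

theorem preimage_swapCol_prod_pi [DecidableEq K] (i : K) (A B : K → Set 𝕏) :
    swapCol i ⁻¹' (Set.univ.pi A ×ˢ Set.univ.pi B)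
      = Set.univ.pi (Function.update A i (B i)) ×ˢ Set.univ.pi (Function.update B i (A i)) := by
  ext ⟨y, z⟩
  simp only [swapCol, Set.mem_preimage, Set.mem_prod, Set.mem_univ_pi, ← forall_and]
  refine forall_congr' fun j => ?_
  by_cases h : j = i
  · subst h; simp [and_comm]
  · simp [h]

theorem colSelect_mulSingle [DecidableEq K] (i : K) (τ : Equiv.Perm α) (x : α → K → 𝕏) :
    colSelect (fun j => (Pi.mulSingle i τ : K → Equiv.Perm α) j) x
      = fun m j => if j = i then x (τ m) j else x m j := by
  ext m j
  by_cases h : j = i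
  · subst h; simp [colSelect]
  · simp [colSelect, h]

theorem colSelect_mulSingle_swap_castSucc_snoc [DecidableEq K] (i : K) {n : ℕ} (a b : Fin n)
    (x : Fin n → K → 𝕏) (y : K → 𝕏) :
    colSelect (fun j => (Pi.mulSingle i (Equiv.swap a.castSucc b.castSucc) :
        K → Equiv.Perm (Fin (n + 1))) j) (Fin.snoc x y : Fin (n + 1) → K → 𝕏)
      = Fin.snoc (colSelect (fun j => (Pi.mulSingle i (Equiv.swap a b) :
        K → Equiv.Perm (Fin n)) j) x) y := by
  rw [colSelect_mulSingle, colSelect_mulSingle]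
  ext m j
  by_cases h : j = i
  · subst h
    induction m using Fin.lastCases with
    | last =>
      rw [Equiv.swap_apply_of_ne_of_ne (Fin.castSucc_lt_last a).ne' (Fin.castSucc_lt_last b).ne']
      simp
    | cast m =>
      have : Equiv.swap a.castSucc b.castSucc m.castSucc = (Equiv.swap a b m).castSucc := by
        simp only [Equiv.swap_apply_def, Fin.castSucc_inj]
        split_ifs <;> rfl
      simp [this]
  · induction m using Fin.lastCases <;> simp [h]

theorem colSelect_mulSingle_swap_last_snoc [DecidableEq K] (i : K) {n : ℕ}
    (x : Fin n → K → 𝕏) (p : (K → 𝕏) × (K → 𝕏)) :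
    colSelect (fun j => (Pi.mulSingle i (Equiv.swap (Fin.last n).castSucc (Fin.last n).succ) :
        K → Equiv.Perm (Fin (n + 2))) j)
        (Fin.snoc (Fin.snoc x p.1 : Fin (n + 1) → K → 𝕏) p.2 : Fin (n + 2) → K → 𝕏)
      = Fin.snoc (Fin.snoc x (swapCol i p).1 : Fin (n + 1) → K → 𝕏) (swapCol i p).2 := by
  rw [colSelect_mulSingle]
  ext m j
  rw [Fin.succ_last]
  by_cases h : j = i
  · subst h
    induction m using Fin.lastCases with
    | last => simp [swapCol]
    | cast m =>
      induction m using Fin.lastCases with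
      | last => simp [swapCol]
      | cast m =>
        rw [Equiv.swap_apply_of_ne_of_ne
          (fun h => (Fin.castSucc_lt_last m).ne (Fin.castSucc_injective _ h))
          (Fin.castSucc_lt_last _).ne]
        simp
  · induction m using Fin.lastCases with
    | last => simp [swapCol, h]
    | cast m => induction m using Fin.lastCases <;> simp [swapCol, h]

variable [MeasurableSpace Ω] [MeasurableSpace 𝕐] [MeasurableSpace 𝕏]

theorem measurable_colSelect (e : K → α → β) : Measurable (colSelect (𝕏 := 𝕏) e) := by
  refine measurable_pi_lambda _ fun a => measurable_pi_lambda _ fun j => ?_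
  exact (measurable_pi_apply j).comp (measurable_pi_apply (e j a))

theorem MeasurableSet.univ_pi_update [Countable K] [DecidableEq K] {A : K → Set 𝕏}
    (hA : ∀ j, MeasurableSet (A j)) {i : K} {s : Set 𝕏} (hs : MeasurableSet s) :
    MeasurableSet (Set.univ.pi (Function.update A i s)) := by
  refine MeasurableSet.univ_pi fun j => ?_
  by_cases hj : j = i
  · subst hj; simpa using hs
  · simpa [hj] using hA j

theorem measurable_pastRows {Y : ℕ → Ω → 𝕐} (hY : ∀ n, Measurable (Y n)) (n : ℕ) :
    Measurable (pastRows Y n) :=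
  measurable_pi_lambda _ fun i => hY i

theorem measurable_snocRow (n : ℕ) :
    Measurable fun p : (Fin n → 𝕐) × 𝕐 => (Fin.snoc p.1 p.2 : Fin (n + 1) → 𝕐) := by
  refine measurable_pi_lambda _ fun a => ?_
  induction a using Fin.lastCases with
  | last => simpa using measurable_snd
  | cast a => simpa [Function.comp_def] using (measurable_pi_apply a).comp measurable_fst

theorem measurable_snocRow_right {n : ℕ} (x : Fin n → 𝕐) :
    Measurable fun y : 𝕐 => (Fin.snoc x y : Fin (n + 1) → 𝕐) :=
  (measurable_snocRow n).comp measurable_prodMk_left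

theorem measurable_swapCol [DecidableEq K] (i : K) : Measurable (swapCol (𝕏 := 𝕏) i) := by
  refine Measurable.prodMk ?_ ?_ <;> refine measurable_pi_lambda _ fun j => ?_
  · by_cases h : j = i
    · subst h; simpa [Function.comp_def] using (measurable_pi_apply j).comp measurable_snd
    · simpa [h, Function.comp_def] using (measurable_pi_apply j).comp measurable_fst
  · by_cases h : j = i
    · subst h; simpa [Function.comp_def] using (measurable_pi_apply j).comp measurable_fst
    · simpa [h, Function.comp_def] using (measurable_pi_apply j).comp measurable_snd

/-- Two finite measures on a finite power agree if they agree on measurable rectangles. -/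
theorem measure_ext_pi [Finite K] {ρ ρ' : Measure (K → 𝕏)} [IsFiniteMeasure ρ]
    (h : ∀ A : K → Set 𝕏, (∀ j, MeasurableSet (A j)) →
      ρ (Set.univ.pi A) = ρ' (Set.univ.pi A)) : ρ = ρ' := by
  refine ext_of_generate_finite _ generateFrom_pi.symm isPiSystem_pi ?_ ?_
  · rintro _ ⟨A, hA, rfl⟩
    exact h A fun j => hA j trivial
  · simpa using h (fun _ => Set.univ) fun _ => MeasurableSet.univ

/-- Two finite measures on the square of a finite power agree if they agree on products of
measurable rectangles. -/
theorem measure_ext_pi_prod_pi [Finite K] {ρ ρ' : Measure ((K → 𝕏) × (K → 𝕏))}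
    [IsFiniteMeasure ρ] [IsFiniteMeasure ρ']
    (h : ∀ A B : K → Set 𝕏, (∀ j, MeasurableSet (A j)) → (∀ j, MeasurableSet (B j)) →
      ρ (Set.univ.pi A ×ˢ Set.univ.pi B) = ρ' (Set.univ.pi A ×ˢ Set.univ.pi B)) : ρ = ρ' := by
  have snd_slice : ∀ (A : K → Set 𝕏), (∀ j, MeasurableSet (A j)) → ∀ t, MeasurableSet t →
      ρ (Set.univ.pi A ×ˢ t) = ρ' (Set.univ.pi A ×ˢ t) := by
    intro A hA t ht
    have hA' : MeasurableSet (Set.univ.pi A) := MeasurableSet.univ_pi hA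
    have key : (ρ.restrict (Prod.fst ⁻¹' Set.univ.pi A)).map Prod.snd
        = (ρ'.restrict (Prod.fst ⁻¹' Set.univ.pi A)).map Prod.snd := by
      refine measure_ext_pi fun B hB => ?_
      have hB' : MeasurableSet (Set.univ.pi B) := MeasurableSet.univ_pi hB
      rw [Measure.map_apply measurable_snd hB', Measure.map_apply measurable_snd hB',
        Measure.restrict_apply (measurable_snd hB'), Measure.restrict_apply (measurable_snd hB'),
        Set.inter_comm, ← Set.prod_eq]
      exact h A B hA hB
    have := DFunLike.congr_fun key t
    rwa [Measure.map_apply measurable_snd ht, Measure.map_apply measurable_snd ht,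
      Measure.restrict_apply (measurable_snd ht), Measure.restrict_apply (measurable_snd ht),
      Set.inter_comm, ← Set.prod_eq] at this
  refine Measure.ext_prod fun {s t} hs ht => ?_
  have key : (ρ.restrict (Prod.snd ⁻¹' t)).map Prod.fst
      = (ρ'.restrict (Prod.snd ⁻¹' t)).map Prod.fst := by
    refine measure_ext_pi fun A hA => ?_
    have hA' : MeasurableSet (Set.univ.pi A) := MeasurableSet.univ_pi hA
    rw [Measure.map_apply measurable_fst hA', Measure.map_apply measurable_fst hA',
      Measure.restrict_apply (measurable_fst hA'), Measure.restrict_apply (measurable_fst hA'),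
      ← Set.prod_eq]
    exact snd_slice A hA t ht
  have := DFunLike.congr_fun key s
  rwa [Measure.map_apply measurable_fst hs, Measure.map_apply measurable_fst hs,
    Measure.restrict_apply (measurable_fst hs), Measure.restrict_apply (measurable_fst hs),
    ← Set.prod_eq] at this

/-- The conditional law of the next two terms obtained by chaining one-step kernels. -/
noncomputable def twoStep (P : (n : ℕ) → Kernel (Fin n → 𝕐) 𝕐) (n : ℕ) :
    Kernel (Fin n → 𝕐) (𝕐 × 𝕐) :=
  P n ⊗ₖ (P (n + 1)).comap (fun p => (Fin.snoc p.1 p.2 : Fin (n + 1) → 𝕐)) (measurable_snocRow n)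

instance isMarkovKernel_twoStep (P : (n : ℕ) → Kernel (Fin n → 𝕐) 𝕐)
    [∀ n, IsMarkovKernel (P n)] (n : ℕ) : IsMarkovKernel (twoStep P n) := by
  unfold twoStep; infer_instance

theorem twoStep_prod (P : (n : ℕ) → Kernel (Fin n → 𝕐) 𝕐)
    [∀ n, IsMarkovKernel (P n)] (n : ℕ) (x : Fin n → 𝕐) {s t : Set 𝕐}
    (hs : MeasurableSet s) (ht : MeasurableSet t) :
    twoStep P n x (s ×ˢ t) = ∫⁻ y in s, P (n + 1) (Fin.snoc x y) t ∂(P n x) := by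
  unfold twoStep
  rw [Kernel.compProd_apply_prod hs ht]
  rfl

theorem isPredictiveRule_iff_compProd {μ : Measure Ω} [IsFiniteMeasure μ] {Y : ℕ → Ω → 𝕐}
    (hY : ∀ n, Measurable (Y n)) (P : (n : ℕ) → Kernel (Fin n → 𝕐) 𝕐)
    [∀ n, IsMarkovKernel (P n)] :
    IsPredictiveRule μ Y P ↔
      ∀ n, μ.map (pastRows Y n) ⊗ₘ P n = μ.map fun ω => (pastRows Y n ω, Y n ω) := by
  have hm (n : ℕ) : Measurable fun ω => (pastRows Y n ω, Y n ω) :=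
    (measurable_pastRows hY n).prodMk (hY n)
  constructor
  · intro h n
    refine Measure.ext_prod fun {s t} hs ht => ?_
    rw [Measure.compProd_apply_prod hs ht, Measure.map_apply (hm n) (hs.prod ht)]
    exact (h n t s ht hs).symm
  · intro h n A B hA hB
    have := DFunLike.congr_fun (h n) (B ×ˢ A)
    rw [Measure.compProd_apply_prod hB hA, Measure.map_apply (hm n) (hB.prod hA)] at this
    exact this.symm

theorem compProd_twoStep {μ : Measure Ω} [IsFiniteMeasure μ] {Y : ℕ → Ω → 𝕐}
    (hY : ∀ n, Measurable (Y n)) (P : (n : ℕ) → Kernel (Fin n → 𝕐) 𝕐)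
    [∀ n, IsMarkovKernel (P n)]
    (h : ∀ n, μ.map (pastRows Y n) ⊗ₘ P n = μ.map fun ω => (pastRows Y n ω, Y n ω)) (n : ℕ) :
    μ.map (pastRows Y n) ⊗ₘ twoStep P n
      = μ.map fun ω => (pastRows Y n ω, (Y n ω, Y (n + 1) ω)) := by
  have hm (n : ℕ) : Measurable fun ω => (pastRows Y n ω, Y n ω) :=
    (measurable_pastRows hY n).prodMk (hY n)
  refine Measure.ext_of_lintegral _ fun f hf => ?_
  have hinit : Measurable fun w : Fin (n + 1) → 𝕐 => (fun a : Fin n => w a.castSucc) :=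
    measurable_pi_lambda _ fun a => measurable_pi_apply _
  have hg : Measurable fun p : (Fin (n + 1) → 𝕐) × 𝕐 =>
      f ((fun a : Fin n => p.1 a.castSucc), (p.1 (Fin.last n), p.2)) :=
    hf.comp ((hinit.comp measurable_fst).prodMk
      (((measurable_pi_apply _).comp measurable_fst).prodMk measurable_snd))
  rw [Measure.lintegral_compProd hf]
  unfold twoStep
  have h1 : ∀ x, ∫⁻ p, f (x, p) ∂((P n ⊗ₖ (P (n + 1)).comap
      (fun p => (Fin.snoc p.1 p.2 : Fin (n + 1) → 𝕐)) (measurable_snocRow n)) x)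
      = ∫⁻ y, ∫⁻ z, f (x, (y, z)) ∂(P (n + 1) (Fin.snoc x y)) ∂(P n x) := by
    intro x
    rw [Kernel.lintegral_compProd _ _ _ (f := fun p => f (x, p)) (hf.comp measurable_prodMk_left)]
    rfl
  simp_rw [h1]
  have hin : Measurable fun w : Fin (n + 1) → 𝕐 =>
      ∫⁻ z, f ((fun a : Fin n => w a.castSucc), (w (Fin.last n), z)) ∂(P (n + 1) w) :=
    hg.lintegral_kernel_prod_right'
  have hin2 := hin.comp (measurable_snocRow (𝕐 := 𝕐) n)
  have h2 := Measure.lintegral_compProd (μ := μ.map (pastRows Y n)) (κ := P n) hin2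
  simp only [Function.comp_apply, Fin.snoc_castSucc, Fin.snoc_last] at h2
  rw [← h2, h n, lintegral_map (by simpa [Function.comp_def] using hin2) (hm n)]
  simp only [← pastRows_succ]
  have h3 := Measure.lintegral_compProd (μ := μ.map (pastRows Y (n + 1))) (κ := P (n + 1)) hg
  rw [h (n + 1), lintegral_map hg (hm (n + 1)),
    lintegral_map hin (measurable_pastRows hY (n + 1))] at h3
  rw [lintegral_map hf ((measurable_pastRows hY n).prodMk ((hY n).prodMk (hY (n + 1))))]
  exact h3.symm

/-- Invariance of the law of an array under adjacent transpositions in single columns implies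
invariance under separate permutations of all columns. -/
theorem map_colSelect_of_adjacent [Finite K] [DecidableEq K] {n : ℕ}
    {ν : Measure (Fin (n + 1) → K → 𝕏)}
    (h : ∀ (i : K) (a : Fin n),
      ν.map (colSelect fun j => (Pi.mulSingle i (Equiv.swap a.castSucc a.succ) :
        K → Equiv.Perm (Fin (n + 1))) j) = ν)
    (g : K → Equiv.Perm (Fin (n + 1))) : ν.map (colSelect fun j => g j) = ν := by
  let H : Submonoid (K → Equiv.Perm (Fin (n + 1))) :=
    { carrier := {g | ν.map (colSelect fun j => g j) = ν}
      one_mem' := Measure.map_id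
      mul_mem' := by
        intro g₁ g₂ (h₁ : ν.map (colSelect fun j => g₁ j) = ν)
          (h₂ : ν.map (colSelect fun j => g₂ j) = ν)
        change ν.map (colSelect fun j => (g₁ * g₂) j) = ν
        conv_rhs => rw [← h₂, ← h₁]
        rw [Measure.map_map (measurable_colSelect _) (measurable_colSelect _)]
        rfl }
  change g ∈ H
  refine Submonoid.pi_mem_of_mulSingle_mem g fun i => ?_
  have key : (⊤ : Submonoid (Equiv.Perm (Fin (n + 1))))
      ≤ H.comap (MonoidHom.mulSingle (fun _ : K => Equiv.Perm (Fin (n + 1))) i) := by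
    rw [← Equiv.Perm.mclosure_swap_castSucc_succ, Submonoid.closure_le]
    rintro _ ⟨a, rfl⟩
    exact h i a
  exact key (Submonoid.mem_top (g i))

/-- The law of the rows is invariant under separate column permutations if the predictive kernels
are symmetric in the past within each column and the two-step kernels are symmetric under
exchanges within each column. -/
theorem map_colSelect_pastRows [Finite K] [DecidableEq K] {μ : Measure Ω} [IsFiniteMeasure μ]
    {Y : ℕ → Ω → K → 𝕏} (hY : ∀ n, Measurable (Y n))
    (P : (n : ℕ) → Kernel (Fin n → K → 𝕏) (K → 𝕏)) [∀ n, IsMarkovKernel (P n)]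
    (hP : ∀ n, μ.map (pastRows Y n) ⊗ₘ P n = μ.map fun ω => (pastRows Y n ω, Y n ω))
    (hsymm : ∀ n (i : K) (τ : Equiv.Perm (Fin n)) x,
      P n (colSelect (fun j => (Pi.mulSingle i τ : K → Equiv.Perm (Fin n)) j) x) = P n x)
    (hswap : ∀ n (i : K), (twoStep P n).map (swapCol i) = twoStep P n)
    (n : ℕ) (g : K → Equiv.Perm (Fin n)) :
    (μ.map (pastRows Y n)).map (colSelect fun j => g j) = μ.map (pastRows Y n) := by
  induction n with
  | zero =>
    have : (colSelect fun j => g j : (Fin 0 → K → 𝕏) → Fin 0 → K → 𝕏) = id := by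
      ext x a; exact a.elim0
    rw [this, Measure.map_id]
  | succ n ih =>
    refine map_colSelect_of_adjacent (fun i a => ?_) g
    have hpast := measurable_pastRows hY
    cases n with
    | zero => exact a.elim0
    | succ n =>
    induction a using Fin.lastCases with
    | cast a =>
      have hm : Measurable fun ω => (pastRows Y (n + 1) ω, Y (n + 1) ω) :=
        (hpast _).prodMk (hY _)
      have hlaw : μ.map (pastRows Y (n + 2))
          = (μ.map (pastRows Y (n + 1)) ⊗ₘ P (n + 1)).map
            (fun p => (Fin.snoc p.1 p.2 : Fin (n + 2) → K → 𝕏)) := by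
        rw [hP, Measure.map_map (measurable_snocRow _) hm]
        congr 1; ext1 ω; exact pastRows_succ Y _ ω
      set γ : (Fin (n + 1) → K → 𝕏) → Fin (n + 1) → K → 𝕏 := colSelect fun j =>
        (Pi.mulSingle i (Equiv.swap a.castSucc a.succ) : K → Equiv.Perm (Fin (n + 1))) j with hγ
      have hγm : Measurable γ := measurable_colSelect _
      have hinv : (μ.map (pastRows Y (n + 1)) ⊗ₘ P (n + 1)).map (Prod.map γ id)
          = μ.map (pastRows Y (n + 1)) ⊗ₘ P (n + 1) := by
        refine Measure.ext_of_lintegral _ fun f hf => ?_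
        rw [lintegral_map hf (hγm.prodMap measurable_id),
          Measure.lintegral_compProd (f := fun p => f (Prod.map γ id p))
            (hf.comp (hγm.prodMap measurable_id)),
          Measure.lintegral_compProd hf]
        conv_rhs => rw [← ih (Pi.mulSingle i (Equiv.swap a.castSucc a.succ))]
        rw [lintegral_map hf.lintegral_kernel_prod_right' hγm]
        refine lintegral_congr fun x => ?_
        rw [hγ, hsymm]
        rfl
      rw [hlaw, Measure.map_map (measurable_colSelect _) (measurable_snocRow _)]
      conv_rhs => rw [← hinv, Measure.map_map (measurable_snocRow _) (hγm.prodMap measurable_id)]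
      congr 1; ext1 p
      exact colSelect_mulSingle_swap_castSucc_snoc i a.castSucc a.succ p.1 p.2
    | last =>
      let ψ : (Fin n → K → 𝕏) × ((K → 𝕏) × (K → 𝕏)) → Fin (n + 2) → K → 𝕏 :=
        fun p => Fin.snoc (Fin.snoc p.1 p.2.1 : Fin (n + 1) → K → 𝕏) p.2.2
      have hψ : Measurable ψ := (measurable_snocRow (n + 1)).comp
        (((measurable_snocRow n).comp
          (measurable_fst.prodMk (measurable_fst.comp measurable_snd))).prodMk
          (measurable_snd.comp measurable_snd))
      have hlaw : μ.map (pastRows Y (n + 2)) = (μ.map (pastRows Y n) ⊗ₘ twoStep P n).map ψ := by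
        rw [compProd_twoStep hY P hP,
          Measure.map_map hψ ((hpast n).prodMk ((hY n).prodMk (hY (n + 1))))]
        congr 1; ext1 ω
        rw [pastRows_succ, pastRows_succ]; rfl
      have hs := measurable_swapCol (𝕏 := 𝕏) i
      rw [hlaw, Measure.map_map (measurable_colSelect _) hψ]
      conv_rhs => rw [← hswap n i, Measure.compProd_map hs,
        Measure.map_map hψ (measurable_id.prodMap hs)]
      congr 1; ext1 p
      exact colSelect_mulSingle_swap_last_snoc i p.1 p.2

/-- The law of the first rows of an array is unchanged by separate injective selections of the
entries in each column. -/
def ColumnExchangeable (μ : Measure Ω) (Y : ℕ → Ω → K → 𝕏) : Prop :=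
  ∀ (N : ℕ) (e : K → Fin N → ℕ), (∀ j, Function.Injective (e j)) →
    μ.map (fun ω a j => Y (e j a) ω j) = μ.map (pastRows Y N)

theorem ColumnExchangeable.map_comp {μ : Measure Ω} {Y : ℕ → Ω → K → 𝕏}
    (h : ColumnExchangeable μ Y) (hY : ∀ n, Measurable (Y n)) {N : ℕ} (e : K → Fin N → ℕ)
    (he : ∀ j, Function.Injective (e j)) {φ : (Fin N → K → 𝕏) → β} [MeasurableSpace β]
    (hφ : Measurable φ) :
    μ.map (fun ω => φ fun a j => Y (e j a) ω j) = μ.map fun ω => φ (pastRows Y N ω) := by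
  have hm : Measurable fun ω (a : Fin N) j => Y (e j a) ω j :=
    measurable_pi_lambda _ fun a => measurable_pi_lambda _ fun j =>
      (measurable_pi_apply j).comp (hY (e j a))
  have := congrArg (Measure.map φ) (h N e he)
  rwa [Measure.map_map hφ hm, Measure.map_map hφ (measurable_pastRows hY N)] at this

theorem ColumnExchangeable.map_colSelect {μ : Measure Ω} {Y : ℕ → Ω → K → 𝕏}
    (h : ColumnExchangeable μ Y) (hY : ∀ n, Measurable (Y n)) {m n : ℕ}
    (e : K → Fin m ↪ Fin n) :
    (μ.map (pastRows Y n)).map (colSelect fun j => e j) = μ.map (pastRows Y m) := by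
  rw [Measure.map_map (measurable_colSelect _) (measurable_pastRows hY n)]
  exact h m (fun j a => e j a) fun j => Fin.val_injective.comp (e j).injective

theorem measurable_initRows (n : ℕ) :
    Measurable fun w : Fin (n + 1) → 𝕐 => (fun a : Fin n => w a.castSucc) :=
  measurable_pi_lambda _ fun _ => measurable_pi_apply _

theorem ColumnExchangeable.map_colSelect_prod {μ : Measure Ω} {Y : ℕ → Ω → K → 𝕏}
    (h : ColumnExchangeable μ Y) (hY : ∀ n, Measurable (Y n)) {n : ℕ}
    (g : K → Equiv.Perm (Fin n)) :
    μ.map (fun ω => (colSelect (fun j => g j) (pastRows Y n ω), Y n ω))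
      = μ.map fun ω => (pastRows Y n ω, Y n ω) := by
  let e : K → Fin (n + 1) → ℕ := fun j =>
    Fin.snoc (α := fun _ => ℕ) (fun a => (g j a : ℕ)) n
  have he (j : K) : Function.Injective (e j) :=
    Fin.snoc_injective_of_injective (Fin.val_injective.comp (g j).injective)
      (by rintro ⟨a, ha⟩; exact (g j a).isLt.ne ha)
  have := h.map_comp hY e he ((measurable_initRows (𝕐 := K → 𝕏) n).prodMk
    (measurable_pi_apply (Fin.last n)))
  simp only [e, Fin.snoc_castSucc, Fin.snoc_last] at this
  exact this

theorem ColumnExchangeable.map_swapCol {μ : Measure Ω} [DecidableEq K] {Y : ℕ → Ω → K → 𝕏}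
    (h : ColumnExchangeable μ Y) (hY : ∀ n, Measurable (Y n)) (n : ℕ) (i : K) :
    μ.map (fun ω => (pastRows Y n ω, swapCol i (Y n ω, Y (n + 1) ω)))
      = μ.map fun ω => (pastRows Y n ω, (Y n ω, Y (n + 1) ω)) := by
  let e : K → Fin (n + 2) → ℕ := fun j a => if j = i then Equiv.swap n (n + 1) a else a
  have he (j : K) : Function.Injective (e j) := by
    by_cases hj : j = i
    · simp only [e, hj, if_true]
      exact (Equiv.swap n (n + 1)).injective.comp Fin.val_injective
    · simpa [e, hj] using Fin.val_injective
  have := h.map_comp hY e he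
    (((measurable_initRows (𝕐 := K → 𝕏) n).comp (measurable_initRows (n + 1))).prodMk
      ((measurable_pi_apply (Fin.last n).castSucc).prodMk
        (measurable_pi_apply (Fin.last (n + 1)))))
  convert! this using 2
  · ext1 ω
    refine Prod.ext ?_ (Prod.ext ?_ ?_)
    · ext a j
      have h1 : (a : ℕ) ≠ n := a.isLt.ne
      have h2 : (a : ℕ) ≠ n + 1 := (a.isLt.trans (Nat.lt_succ_self n)).ne
      simp [pastRows, e, Equiv.swap_apply_of_ne_of_ne h1 h2]
    · ext j
      by_cases hj : j = i
      · subst hj; simp [swapCol, e]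
      · simp [swapCol, e, hj]
    · ext j
      by_cases hj : j = i
      · subst hj; simp [swapCol, e]
      · simp [swapCol, e, hj]

/-- Null sets of pasts can be enlarged to null sets that are stable under passing to longer pasts
and are not reached by the predictive kernels from outside. -/
theorem ColumnExchangeable.exists_stable_null [Finite K] {μ : Measure Ω} [IsFiniteMeasure μ]
    {Y : ℕ → Ω → K → 𝕏} (h : ColumnExchangeable μ Y) (hY : ∀ n, Measurable (Y n))
    (Q : (n : ℕ) → Kernel (Fin n → K → 𝕏) (K → 𝕏)) [∀ n, IsMarkovKernel (Q n)]
    (hQ : ∀ n, μ.map (pastRows Y n) ⊗ₘ Q n = μ.map fun ω => (pastRows Y n ω, Y n ω))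
    (N : (n : ℕ) → Set (Fin n → K → 𝕏)) (hN : ∀ n, MeasurableSet (N n))
    (hN0 : ∀ n, μ.map (pastRows Y n) (N n) = 0) :
    ∃ B : (n : ℕ) → Set (Fin n → K → 𝕏), (∀ n, MeasurableSet (B n)) ∧
      (∀ n, μ.map (pastRows Y n) (B n) = 0) ∧ (∀ n, N n ⊆ B n) ∧
      (∀ (m n : ℕ) (e : K → Fin m ↪ Fin n) (x : Fin n → K → 𝕏),
        colSelect (fun j => e j) x ∈ B m → x ∈ B n) ∧
      (∀ n, ∀ x ∉ B n, Q n x {y | (Fin.snoc x y : Fin (n + 1) → K → 𝕏) ∈ B (n + 1)} = 0) := by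
  let step : ((n : ℕ) → Set (Fin n → K → 𝕏)) → (n : ℕ) → Set (Fin n → K → 𝕏) := fun B n =>
    (B n ∪ ⋃ (m : ℕ) (e : K → Fin m ↪ Fin n), (colSelect fun j => e j) ⁻¹' B m) ∪
      {x | Q n x {y | (Fin.snoc x y : Fin (n + 1) → K → 𝕏) ∈ B (n + 1)} ≠ 0}
  let C : ℕ → (n : ℕ) → Set (Fin n → K → 𝕏) := fun t => step^[t] N
  have hC (t : ℕ) : C (t + 1) = step (C t) := Function.iterate_succ_apply' step t N
  have hCm (t : ℕ) : ∀ n, MeasurableSet (C t n) := by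
    induction t with
    | zero => exact hN
    | succ t ih =>
      intro n
      rw [hC]
      refine ((ih n).union (.iUnion fun m => .iUnion fun e =>
        measurable_colSelect _ (ih m))).union ?_
      have hs := Kernel.measurable_kernel_prodMk_left (κ := Q n)
        (measurable_snocRow n (ih (n + 1)))
      exact (hs (measurableSet_singleton 0)).compl
  have hC0 (t : ℕ) : ∀ n, μ.map (pastRows Y n) (C t n) = 0 := by
    induction t with
    | zero => exact hN0
    | succ t ih =>
      intro n
      rw [hC]
      have hmeas : MeasurableSet {p : (Fin n → K → 𝕏) × (K → 𝕏) |
          (Fin.snoc p.1 p.2 : Fin (n + 1) → K → 𝕏) ∈ C t (n + 1)} :=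
        measurable_snocRow n (hCm t (n + 1))
      refine measure_union_null (measure_union_null (ih n) ?_) ?_
      · refine measure_iUnion_null fun m => measure_iUnion_null fun e => ?_
        rw [← Measure.map_apply (measurable_colSelect _) (hCm t m), h.map_colSelect hY e]
        exact ih m
      · have hz : (μ.map (pastRows Y n) ⊗ₘ Q n)
            {p | (Fin.snoc p.1 p.2 : Fin (n + 1) → K → 𝕏) ∈ C t (n + 1)} = 0 := by
          rw [hQ, Measure.map_apply ((measurable_pastRows hY n).prodMk (hY n))
            hmeas, ← ih (n + 1),
            Measure.map_apply (measurable_pastRows hY (n + 1)) (hCm t (n + 1))]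
          congr 1
          ext ω
          simp [pastRows_succ]
        rw [Measure.compProd_apply hmeas,
          lintegral_eq_zero_iff (Kernel.measurable_kernel_prodMk_left (κ := Q n)
            hmeas)] at hz
        exact hz
  refine ⟨fun n => ⋃ t, C t n, fun n => .iUnion fun t => hCm t n,
    fun n => measure_iUnion_null fun t => hC0 t n, fun n => Set.subset_iUnion_of_subset 0 subset_rfl,
    fun m n e x hx => ?_, fun n x hx => ?_⟩
  · obtain ⟨t, ht⟩ := Set.mem_iUnion.1 hx
    refine Set.mem_iUnion.2 ⟨t + 1, ?_⟩
    rw [hC]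
    exact Or.inl (Or.inr (Set.mem_iUnion.2 ⟨m, Set.mem_iUnion.2 ⟨e, ht⟩⟩))
  · have : {y | (Fin.snoc x y : Fin (n + 1) → K → 𝕏) ∈ ⋃ t, C t (n + 1)}
        = ⋃ t, {y | (Fin.snoc x y : Fin (n + 1) → K → 𝕏) ∈ C t (n + 1)} := by
      ext y; simp
    rw [this]
    refine measure_iUnion_null fun t => ?_
    by_contra hne
    refine hx (Set.mem_iUnion.2 ⟨t + 1, ?_⟩)
    rw [hC]
    exact Or.inr hne

/-- A column exchangeable array admits predictive kernels that are symmetric everywhere. -/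
theorem ColumnExchangeable.exists_symmetric_kernels [Finite K] [DecidableEq K]
    [StandardBorelSpace 𝕏] [Nonempty (K → 𝕏)] {μ : Measure Ω} [IsFiniteMeasure μ]
    {Y : ℕ → Ω → K → 𝕏} (h : ColumnExchangeable μ Y) (hY : ∀ n, Measurable (Y n)) :
    ∃ P : (n : ℕ) → Kernel (Fin n → K → 𝕏) (K → 𝕏), ∃ _ : ∀ n, IsMarkovKernel (P n),
      (∀ n, μ.map (pastRows Y n) ⊗ₘ P n = μ.map fun ω => (pastRows Y n ω, Y n ω)) ∧
      (∀ n (g : K → Equiv.Perm (Fin n)) x, P n (colSelect (fun j => g j) x) = P n x) ∧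
      (∀ n (i : K), (twoStep P n).map (swapCol i) = twoStep P n) := by
  have hpast := measurable_pastRows hY
  let Q : (n : ℕ) → Kernel (Fin n → K → 𝕏) (K → 𝕏) := fun n =>
    condDistrib (Y n) (pastRows Y n) μ
  have hQM (n : ℕ) : IsMarkovKernel (Q n) := by unfold Q; infer_instance
  have hQ (n : ℕ) : μ.map (pastRows Y n) ⊗ₘ Q n = μ.map fun ω => (pastRows Y n ω, Y n ω) :=
    compProd_map_condDistrib (hY n).aemeasurable
  have hQsymm (n : ℕ) (g : K → Equiv.Perm (Fin n)) :
      ∀ᵐ x ∂μ.map (pastRows Y n), Q n (colSelect (fun j => g j) x) = Q n x := by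
    have hg := measurable_colSelect (𝕏 := 𝕏) fun j => g j
    have hg' := measurable_colSelect (𝕏 := 𝕏) fun j => (g j).symm
    have hinv : (μ.map (pastRows Y n)).map (colSelect fun j => g j) = μ.map (pastRows Y n) :=
      h.map_colSelect hY fun j => (g j).toEmbedding
    have hfwd : (μ.map (pastRows Y n) ⊗ₘ (Q n).comap _ hg).map
        (Prod.map (colSelect fun j => g j) id) = μ.map (pastRows Y n) ⊗ₘ Q n := by
      refine Measure.ext_of_lintegral _ fun f hf => ?_
      rw [lintegral_map hf (hg.prodMap measurable_id),
        Measure.lintegral_compProd (f := fun p => f (Prod.map _ id p))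
          (hf.comp (hg.prodMap measurable_id)), Measure.lintegral_compProd hf]
      conv_rhs => rw [← hinv]
      rw [lintegral_map hf.lintegral_kernel_prod_right' hg]
      rfl
    have hcomp : Prod.map (colSelect fun j => (g j).symm) id ∘ Prod.map (colSelect fun j => g j) id
        = (id : (Fin n → K → 𝕏) × (K → 𝕏) → _) := by
      ext1 p
      refine Prod.ext ?_ rfl
      ext a j
      simp [colSelect]
    have heq : μ.map (pastRows Y n) ⊗ₘ (Q n).comap _ hg = μ.map (pastRows Y n) ⊗ₘ Q n := by
      have hback := congrArg (Measure.map (Prod.map (colSelect fun j => (g j).symm) id)) hfwd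
      rw [Measure.map_map (hg'.prodMap measurable_id) (hg.prodMap measurable_id), hcomp,
        Measure.map_id, hQ, Measure.map_map (hg'.prodMap measurable_id)
          ((hpast n).prodMk (hY n))] at hback
      rw [hback, hQ]
      exact h.map_colSelect_prod hY fun j => (g j).symm
    exact Kernel.ae_eq_of_compProd_eq heq
  have hQswap (n : ℕ) (i : K) :
      ∀ᵐ x ∂μ.map (pastRows Y n), (twoStep Q n).map (swapCol i) x = twoStep Q n x := by
    have hs := measurable_swapCol (𝕏 := 𝕏) i
    have : IsMarkovKernel ((twoStep Q n).map (swapCol i)) := Kernel.IsMarkovKernel.map _ hs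
    refine Kernel.ae_eq_of_compProd_eq ?_
    rw [Measure.compProd_map hs, compProd_twoStep hY Q hQ,
      Measure.map_map (measurable_id.prodMap hs) ((hpast n).prodMk ((hY n).prodMk (hY (n + 1))))]
    exact h.map_swapCol hY n i
  have hnull (n : ℕ) := (ae_all_iff.2 (hQsymm n)).and (ae_all_iff.2 (hQswap n))
  obtain ⟨B, hBm, hB0, hNB, hBsel, hBQ⟩ := h.exists_stable_null hY Q hQ
    (fun n => toMeasurable (μ.map (pastRows Y n)) {x |
      ¬((∀ g : K → Equiv.Perm (Fin n), Q n (colSelect (fun j => g j) x) = Q n x) ∧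
        ∀ i, (twoStep Q n).map (swapCol i) x = twoStep Q n x)})
    (fun n => measurableSet_toMeasurable _ _)
    (fun n => by rw [measure_toMeasurable]; exact hnull n)
  have hgood (n : ℕ) (x) (hx : x ∉ B n) :
      (∀ g : K → Equiv.Perm (Fin n), Q n (colSelect (fun j => g j) x) = Q n x) ∧
        ∀ i, (twoStep Q n).map (swapCol i) x = twoStep Q n x := by
    by_contra hbad
    exact hx (hNB n (subset_toMeasurable _ _ hbad))
  have hBperm (n : ℕ) (g : K → Equiv.Perm (Fin n)) (x) :
      colSelect (fun j => g j) x ∈ B n ↔ x ∈ B n := by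
    refine ⟨hBsel n n (fun j => (g j).toEmbedding) x, fun hx => ?_⟩
    refine hBsel n n (fun j => (g j).symm.toEmbedding) _ ?_
    convert! hx using 1
    ext a j
    simp [colSelect]
  have hBsnoc (n : ℕ) (x) (hx : x ∈ B n) (y) :
      (Fin.snoc x y : Fin (n + 1) → K → 𝕏) ∈ B (n + 1) := by
    refine hBsel n (n + 1) (fun _ => Fin.castSuccEmb) _ ?_
    convert! hx using 1
    ext a j
    simp [colSelect]
  obtain ⟨y₀⟩ := ‹Nonempty (K → 𝕏)›
  classical
  let P : (n : ℕ) → Kernel (Fin n → K → 𝕏) (K → 𝕏) := fun n =>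
    Kernel.piecewise (hBm n) (Kernel.const _ (Measure.dirac y₀)) (Q n)
  have hPM (n : ℕ) : IsMarkovKernel (P n) := by unfold P; infer_instance
  have hPbad (n : ℕ) (x) (hx : x ∈ B n) : P n x = Measure.dirac y₀ := by
    simp [P, Kernel.piecewise_apply, hx]
  have hPgood (n : ℕ) (x) (hx : x ∉ B n) : P n x = Q n x := by
    simp [P, Kernel.piecewise_apply, hx]
  refine ⟨P, hPM, fun n => ?_, fun n g x => ?_, fun n i => ?_⟩
  · rw [← hQ n]
    refine Measure.compProd_congr ?_
    have : ∀ᵐ x ∂μ.map (pastRows Y n), x ∉ B n := measure_eq_zero_iff_ae_notMem.1 (hB0 n)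
    filter_upwards [this] with x hx using hPgood n x hx
  · by_cases hx : x ∈ B n
    · rw [hPbad n x hx, hPbad n _ ((hBperm n g x).2 hx)]
    · rw [hPgood n x hx, hPgood n _ (mt (hBperm n g x).1 hx), (hgood n x hx).1 g]
  · have hs := measurable_swapCol (𝕏 := 𝕏) i
    ext1 x
    by_cases hx : x ∈ B n
    · have hdirac : twoStep P n x = Measure.dirac (y₀, y₀) := by
        refine Measure.ext_prod fun {s t} hs ht => ?_
        rw [twoStep_prod P n x hs ht]
        simp_rw [fun y => hPbad (n + 1) _ (hBsnoc n x hx y)]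
        rw [hPbad n x hx, lintegral_const, Measure.restrict_apply .univ, Set.univ_inter,
          Measure.dirac_apply' _ hs, Measure.dirac_apply' _ ht,
          Measure.dirac_apply' _ (hs.prod ht)]
        by_cases h1 : y₀ ∈ s <;> by_cases h2 : y₀ ∈ t <;> simp [h1, h2]
      rw [Kernel.map_apply _ hs, hdirac, Measure.map_dirac' hs]
      simp [swapCol]
    · have htwo : twoStep P n x = twoStep Q n x := by
        refine Measure.ext_prod fun {s t} hs ht => ?_
        rw [twoStep_prod P n x hs ht, twoStep_prod Q n x hs ht, hPgood n x hx]
        refine lintegral_congr_ae (ae_restrict_of_ae ?_)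
        have : ∀ᵐ y ∂Q n x, (Fin.snoc x y : Fin (n + 1) → K → 𝕏) ∉ B (n + 1) :=
          measure_eq_zero_iff_ae_notMem.1 (hBQ n x hx)
        filter_upwards [this] with y hy
        rw [hPgood _ _ hy]
      rw [Kernel.map_apply _ hs, htwo, ← Kernel.map_apply _ hs, (hgood n x hx).2 i]

/-- A finite injective tuple of naturals extends to a finitely supported permutation. -/
theorem exists_perm_extending {n : ℕ} (e : Fin n → ℕ) (he : Function.Injective e) :
    ∃ σ : Equiv.Perm ℕ, {m | σ m ≠ m}.Finite ∧ ∀ a : Fin n, σ a = e a := by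
  induction n with
  | zero => exact ⟨1, by simp, fun a => a.elim0⟩
  | succ n ih =>
    obtain ⟨σ, hσ, hσe⟩ := ih (fun a => e a.castSucc) (he.comp (Fin.castSucc_injective n))
    refine ⟨Equiv.swap (σ n) (e (Fin.last n)) * σ, ?_, fun a => ?_⟩
    · refine (hσ.union (Set.toFinite {σ n, e (Fin.last n)})).subset fun m hm => ?_
      by_contra hm'
      simp only [Set.mem_union, Set.mem_insert_iff, Set.mem_singleton_iff, not_or] at hm'
      obtain ⟨h1, h2, h3⟩ := hm'
      have h1 : σ m = m := not_not.1 h1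
      exact hm (by rw [Equiv.Perm.mul_apply, h1, Equiv.swap_apply_of_ne_of_ne h2 h3])
    · induction a using Fin.lastCases with
      | last => simp
      | cast a =>
        rw [Equiv.Perm.mul_apply, Fin.val_castSucc, hσe, Equiv.swap_apply_of_ne_of_ne]
        · rw [← hσe]
          exact fun h => a.isLt.ne (σ.injective h)
        · exact fun h => (Fin.castSucc_lt_last a).ne (he h)

theorem PartiallyExchangeable.columnExchangeable {J : Type*} {μ : Measure Ω}
    {X : ℕ → J → Ω → 𝕏} (hX : ∀ n j, Measurable (X n j)) (h : PartiallyExchangeable μ X)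
    {c : K → J} (hc : Function.Injective c) :
    ColumnExchangeable μ fun n ω i => X n (c i) ω := by
  intro N e he
  choose σ hσ hσe using fun j => exists_perm_extending (e j) (he j)
  have := h (Function.extend c σ 1) fun j => by
    by_cases hj : ∃ i, c i = j
    · obtain ⟨i, rfl⟩ := hj
      rw [hc.extend_apply]
      exact hσ i
    · rw [Function.extend_apply' _ _ _ hj]
      simp
  have hπ : Measurable fun (f : ℕ × J → 𝕏) (a : Fin N) (i : K) => f (a, c i) :=
    measurable_pi_lambda _ fun a => measurable_pi_lambda _ fun i => measurable_pi_apply _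
  have := congrArg (Measure.map fun (f : ℕ × J → 𝕏) (a : Fin N) (i : K) => f (a, c i)) this
  rw [Measure.map_map hπ (measurable_pi_lambda _ fun p => hX _ _),
    Measure.map_map hπ (measurable_pi_lambda _ fun p => hX _ _)] at this
  simp only [Function.comp_def, hc.extend_apply, hσe] at this
  exact this

theorem partiallyExchangeable_of_map_colSelect {J : Type*} {μ : Measure Ω} [IsFiniteMeasure μ]
    {X : ℕ → J → Ω → 𝕏} (hX : ∀ n j, Measurable (X n j))
    (h : ∀ (k : ℕ) (c : Fin k → J), Function.Injective c →
      ∀ (n : ℕ) (g : Fin k → Equiv.Perm (Fin n)),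
        (μ.map (pastRows (fun m ω i => X m (c i) ω) n)).map (colSelect fun j => g j)
          = μ.map (pastRows (fun m ω i => X m (c i) ω) n)) :
    PartiallyExchangeable μ X := by
  classical
  intro σ hσ
  have hfull : Measurable fun ω (p : ℕ × J) => X p.1 p.2 ω :=
    measurable_pi_lambda _ fun p => hX _ _
  have hperm : Measurable fun ω (p : ℕ × J) => X (σ p.2 p.1) p.2 ω :=
    measurable_pi_lambda _ fun p => hX _ _
  refine IsProjectiveLimit.unique
    (P := fun I : Finset (ℕ × J) => (μ.map fun ω (p : ℕ × J) => X p.1 p.2 ω).map I.restrict)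
    (fun I => ?_) fun I => rfl
  let cols := I.image Prod.snd
  obtain ⟨N, hNI, hNσ⟩ : ∃ N : ℕ, (∀ p ∈ I, p.1 < N) ∧ ∀ j ∈ cols, ∀ n, σ j n ≠ n → n < N := by
    have hfin : ((I.image Prod.fst : Finset ℕ) ∪ ⋃ j ∈ cols, {n | σ j n ≠ n} : Set ℕ).Finite :=
      (Finset.finite_toSet _).union (cols.finite_toSet.biUnion fun j _ => hσ j)
    obtain ⟨M, hM⟩ := hfin.bddAbove
    refine ⟨M + 1, fun p hp => Nat.lt_succ_of_le (hM (Or.inl ?_)),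
      fun j hj n hn => Nat.lt_succ_of_le (hM (Or.inr ?_))⟩
    · exact Finset.mem_coe.2 (Finset.mem_image_of_mem _ hp)
    · exact Set.mem_biUnion hj hn
  let c : Fin cols.card → J := fun i => cols.equivFin.symm i
  have hc : Function.Injective c := Subtype.val_injective.comp cols.equivFin.symm.injective
  have hlt (i : Fin cols.card) (a : Fin N) : σ (c i) a < N := by
    by_contra hge
    have hfix : σ (c i) (σ (c i) a) = σ (c i) a := by
      by_contra hne
      exact hge (hNσ _ (cols.equivFin.symm i).2 _ hne)
    exact hge (((σ (c i)).injective hfix).trans_lt a.isLt)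
  let g : Fin cols.card → Equiv.Perm (Fin N) := fun i =>
    Equiv.ofBijective (fun a => ⟨σ (c i) a, hlt i a⟩) (Finite.injective_iff_bijective.1
      fun a b hab => Fin.ext ((σ (c i)).injective (Fin.mk.inj hab)))
  let π : (Fin N → Fin cols.card → 𝕏) → I → 𝕏 := fun w p =>
    w ⟨p.1.1, hNI _ p.2⟩ (cols.equivFin ⟨p.1.2, Finset.mem_image_of_mem _ p.2⟩)
  have hπ : Measurable π := measurable_pi_lambda _ fun p =>
    (measurable_pi_apply _).comp (measurable_pi_apply _)
  have hpast : Measurable (pastRows (fun m ω i => X m (c i) ω) N) :=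
    measurable_pastRows (fun n => measurable_pi_lambda _ fun i => hX _ _) N
  have key := congrArg (Measure.map π) (h _ c hc N g)
  rw [Measure.map_map (measurable_colSelect _) hpast,
    Measure.map_map hπ ((measurable_colSelect _).comp hpast), Measure.map_map hπ hpast] at key
  beta_reduce
  rw [Measure.map_map (Finset.measurable_restrict I) hperm,
    Measure.map_map (Finset.measurable_restrict I) hfull]
  have hcp (p : I) : c (cols.equivFin ⟨p.1.2, Finset.mem_image_of_mem _ p.2⟩) = p.1.2 := by
    simp [c]
  convert! key using 2
  · ext ω p
    simp [π, g, colSelect, pastRows, hcp]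
  · ext ω p
    simp [π, pastRows, hcp]

end PredictiveCharacterization

/-- **Predictive characterization of de Finetti's partial exchangeability.**
A family of sequences is partially exchangeable if and only if, for every finite choice of `k`
(distinct) columns, the predictive rule of the corresponding `𝕏^k`-valued rows can be chosen so
that (i) the predictive probability of every measurable rectangle is a symmetric function of
the past observations within each column, and (ii) the associated two-step set function is
symmetric in `(A_i, B_i)` for every coordinate `i`. -/
theorem statement9
    {Ω 𝕏 J : Type*} [MeasurableSpace Ω] [MeasurableSpace 𝕏] [TopologicalSpace 𝕏]
    [PolishSpace 𝕏] [BorelSpace 𝕏] [Countable J]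
    (μ : Measure Ω) [IsProbabilityMeasure μ]
    (X : ℕ → J → Ω → 𝕏) (hX : ∀ n j, Measurable (X n j)) :
    PartiallyExchangeable μ X ↔
      ∀ (k : ℕ) (c : Fin k → J), Function.Injective c →
        ∃ P : (n : ℕ) → Kernel (Fin n → (Fin k → 𝕏)) (Fin k → 𝕏),
          (∀ n, IsMarkovKernel (P n)) ∧
          IsPredictiveRule μ (fun n ω (i : Fin k) => X n (c i) ω) P ∧
          -- (i) symmetry in the past observations of each column
          (∀ (n : ℕ) (i : Fin k) (τ : Equiv.Perm (Fin n)) (x : Fin n → Fin k → 𝕏)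
            (A : Fin k → Set 𝕏), (∀ j, MeasurableSet (A j)) →
            P n (fun m j => if j = i then x (τ m) j else x m j) (Set.univ.pi A)
              = P n x (Set.univ.pi A)) ∧
          -- (ii) symmetry of the two-step set function in `(A_i, B_i)` for each `i`
          (∀ (n : ℕ) (x : Fin n → Fin k → 𝕏) (A B : Fin k → Set 𝕏),
            (∀ j, MeasurableSet (A j)) → (∀ j, MeasurableSet (B j)) → ∀ i : Fin k,
            ∫⁻ y in Set.univ.pi A, P (n + 1) (Fin.snoc x y) (Set.univ.pi B) ∂(P n x)
              = ∫⁻ y in Set.univ.pi (Function.update A i (B i)),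
                  P (n + 1) (Fin.snoc x y) (Set.univ.pi (Function.update B i (A i)))
                  ∂(P n x)) := by
  have hrow (k : ℕ) (c : Fin k → J) (n : ℕ) : Measurable fun ω (i : Fin k) => X n (c i) ω :=
    measurable_pi_lambda _ fun i => hX n (c i)
  constructor
  · intro h k c hc
    obtain ⟨ω⟩ : Nonempty Ω := nonempty_of_isProbabilityMeasure μ
    have : Nonempty (Fin k → 𝕏) := ⟨fun i => X 0 (c i) ω⟩
    obtain ⟨P, hPM, hP, hsymm, hswap⟩ :=
      (h.columnExchangeable hX hc).exists_symmetric_kernels (hrow k c)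
    refine ⟨P, hPM, (isPredictiveRule_iff_compProd (hrow k c) P).2 hP,
      fun n i τ x A _ => ?_, fun n x A B hA hB i => ?_⟩
    · rw [← colSelect_mulSingle, hsymm]
    · have hupd {A B : Fin k → Set 𝕏} (hA : ∀ j, MeasurableSet (A j))
          (hB : ∀ j, MeasurableSet (B j)) :
          MeasurableSet (Set.univ.pi (Function.update A i (B i))) :=
        .univ_pi fun j => by
          by_cases hj : j = i
          · subst hj; simpa using hB j
          · simpa [hj] using hA j
      have hA' := MeasurableSet.univ_pi hA
      have hB' := MeasurableSet.univ_pi hB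
      rw [← twoStep_prod P n x hA' hB', ← twoStep_prod P n x (.univ_pi_update hA (hB i))
          (.univ_pi_update hB (hA i)),
        ← preimage_swapCol_prod_pi, ← Measure.map_apply (measurable_swapCol i) (hA'.prod hB'),
        ← Kernel.map_apply _ (measurable_swapCol i), hswap]
  · intro h
    refine partiallyExchangeable_of_map_colSelect hX fun k c hc => ?_
    obtain ⟨P, hPM, hP, hsymm, hswap⟩ := h k c hc
    refine map_colSelect_pastRows (hrow k c) P
      ((isPredictiveRule_iff_compProd (hrow k c) P).1 hP) (fun n i τ x => ?_) fun n i => ?_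
    · refine measure_ext_pi fun A hA => ?_
      rw [colSelect_mulSingle, hsymm n i τ x A hA]
    · have hs := measurable_swapCol (𝕏 := 𝕏) i
      have : IsMarkovKernel ((twoStep P n).map (swapCol i)) := Kernel.IsMarkovKernel.map _ hs
      ext1 x
      refine measure_ext_pi_prod_pi fun A B hA hB => ?_
      have hA' := MeasurableSet.univ_pi hA
      have hB' := MeasurableSet.univ_pi hB
      rw [Kernel.map_apply' _ hs _ (hA'.prod hB'), preimage_swapCol_prod_pi,
        twoStep_prod P n x (.univ_pi_update hA (hB i))
          (.univ_pi_update hB (hA i)), twoStep_prod P n x hA' hB']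
      exact (hswap n x A B hA hB i).symm
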